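/- arXiv:2008.08905 — 2 statements merged into one kernel-verified Lean document; each statement's English description precedes it below -/
import Mathlib

section
/- For every function f : ℤ₂ → ℤ₂, Deutsch's algorithm satisfies the identity (H ⊗ I) U_f (H ⊗ H) (I ⊗ X) (b₀ ⊗ b₀) = (−1)^{f(0)} · [ ((1 + (−1)^{f(0)⊕f(1)})/2)·b₀ + ((1 − (−1)^{f(0)⊕f(1)})/2)·b₁ ] ⊗ (1/√2)(b₀ − b₁). -/
/-- The standard basis vector `b_k` of `ℂ²` (indexed by `ℤ₂`). -/
def bv (k : ZMod 2) : ZMod 2 → ℂ := fun l => if l = k then 1 else 0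

/-- Kronecker (tensor) product of vectors of `ℂ²`: the pair `(j, i)` indexes the
component of `b_j ⊗ b_i` (first qubit is the first component). -/
def tensVec (a c : ZMod 2 → ℂ) : ZMod 2 × ZMod 2 → ℂ := fun p => a p.1 * c p.2

/-- Kronecker (tensor) product of one-qubit gates, acting on `ℂ² ⊗ ℂ²`. -/
def kron2 (A B : Matrix (ZMod 2) (ZMod 2) ℂ) :
    Matrix (ZMod 2 × ZMod 2) (ZMod 2 × ZMod 2) ℂ :=
  Matrix.of fun p q => A p.1 q.1 * B p.2 q.2

/-- The Hadamard gate `H = (1/√2)·[[1,1],[1,-1]]`, with entries `(1/√2)·(-1)^{jk}`. -/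
noncomputable def Hgate : Matrix (ZMod 2) (ZMod 2) ℂ :=
  Matrix.of fun a b => (1 / (Real.sqrt 2 : ℂ)) * (-1) ^ (a.val * b.val)

/-- The X gate `X = [[0,1],[1,0]]`: it sends `b_i` to `b_{i+1}`. -/
def Xgate : Matrix (ZMod 2) (ZMod 2) ℂ :=
  Matrix.of fun a b => if a = b + 1 then 1 else 0

/-- The gate `U_f` on `ℂ² ⊗ ℂ²`, defined on the basis by
`U_f (b_j ⊗ b_i) = b_j ⊗ b_{f(j) ⊕ i}`. -/
def Uf (f : ZMod 2 → ZMod 2) :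
    Matrix (ZMod 2 × ZMod 2) (ZMod 2 × ZMod 2) ℂ :=
  Matrix.of fun p q => if p = (q.1, f q.1 + q.2) then 1 else 0

theorem ZMod.sum_univ_two {M : Type*} [AddCommMonoid M] (g : ZMod 2 → M) :
    ∑ i, g i = g 0 + g 1 :=
  Fin.sum_univ_two g

theorem ZMod.eq_zero_or_one (a : ZMod 2) : a = 0 ∨ a = 1 := by
  revert a
  decide

theorem kron2_mulVec_tensVec (A B : Matrix (ZMod 2) (ZMod 2) ℂ) (a c : ZMod 2 → ℂ) :
    (kron2 A B).mulVec (tensVec a c) = tensVec (A.mulVec a) (B.mulVec c) := by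
  ext p
  simp only [Matrix.mulVec, dotProduct, kron2, tensVec, Matrix.of_apply,
    Fintype.sum_prod_type, ZMod.sum_univ_two]
  ring

theorem Xgate_mulVec_bv_zero : Xgate.mulVec (bv 0) = bv 1 := by
  ext i
  simp [Matrix.mulVec, dotProduct, Xgate, bv]

theorem Hgate_mulVec_apply (v : ZMod 2 → ℂ) (j : ZMod 2) :
    Hgate.mulVec v j = (1 / (Real.sqrt 2 : ℂ)) * (v 0 + (-1) ^ j.val * v 1) := by
  simp only [Matrix.mulVec, dotProduct, Hgate, Matrix.of_apply, ZMod.sum_univ_two,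
    ZMod.val_zero, ZMod.val_one, mul_zero, mul_one, pow_zero]
  ring

theorem Hgate_mulVec_bv_zero :
    Hgate.mulVec (bv 0) = fun _ => 1 / (Real.sqrt 2 : ℂ) := by
  ext j
  simp [Hgate_mulVec_apply, bv]

theorem Hgate_mulVec_bv_one :
    Hgate.mulVec (bv 1) = (1 / (Real.sqrt 2 : ℂ)) • (bv 0 - bv 1) := by
  ext j
  rcases ZMod.eq_zero_or_one j with rfl | rfl <;>
    simp [Hgate_mulVec_apply, bv, ZMod.val_one]

theorem Uf_mulVec_apply (f : ZMod 2 → ZMod 2) (v : ZMod 2 × ZMod 2 → ℂ)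
    (p : ZMod 2 × ZMod 2) : (Uf f).mulVec v p = v (p.1, f p.1 + p.2) := by
  have key (q : ZMod 2 × ZMod 2) :
      p = (q.1, f q.1 + q.2) ↔ (p.1, f p.1 + p.2) = q := by
    obtain ⟨j, i⟩ := p
    obtain ⟨k, l⟩ := q
    simp only [Prod.mk.injEq]
    constructor <;> rintro ⟨rfl, rfl⟩ <;> simp [← add_assoc, CharTwo.add_self_eq_zero]
  simp [Matrix.mulVec, dotProduct, Uf, key]

/-- Phase kickback: the second register `b₀ - b₁` is an eigenvector of each shift, so `U_f`
acts on the first register by the phases `(-1)^{f(j)}`. -/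
theorem Uf_mulVec_tensVec_smul_sub (f : ZMod 2 → ZMod 2) (a : ZMod 2 → ℂ) (r : ℂ) :
    (Uf f).mulVec (tensVec a (r • (bv 0 - bv 1))) =
      tensVec (fun j => (-1) ^ (f j).val * a j) (r • (bv 0 - bv 1)) := by
  ext ⟨j, i⟩
  rw [Uf_mulVec_apply]
  simp only [tensVec]
  rcases ZMod.eq_zero_or_one (f j) with h | h <;>
    rcases ZMod.eq_zero_or_one i with rfl | rfl <;>
    simp [h, bv, ZMod.val_one, CharTwo.add_self_eq_zero]

theorem tensVec_smul_left (r : ℂ) (a c : ZMod 2 → ℂ) :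
    r • tensVec a c = tensVec (r • a) c := by
  ext p
  simp [tensVec, mul_assoc]

theorem Hgate_mulVec_phases (f : ZMod 2 → ZMod 2) :
    Hgate.mulVec (fun j => (-1) ^ (f j).val * (1 / (Real.sqrt 2 : ℂ))) =
      ((-1 : ℂ) ^ (f 0).val) •
        (((1 + (-1 : ℂ) ^ (f 0 + f 1).val) / 2) • bv 0 +
          ((1 - (-1 : ℂ) ^ (f 0 + f 1).val) / 2) • bv 1) := by
  have hs : (1 / (Real.sqrt 2 : ℂ)) * (1 / (Real.sqrt 2 : ℂ)) = 1 / 2 := by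
    rw [div_mul_div_comm, ← Complex.ofReal_mul, Real.mul_self_sqrt zero_le_two]
    norm_num
  have hmul (x y z : ℂ) : (1 / (Real.sqrt 2 : ℂ)) *
      (x * (1 / (Real.sqrt 2 : ℂ)) + y * (z * (1 / (Real.sqrt 2 : ℂ)))) =
      (x + y * z) / 2 := by
    linear_combination (x + y * z) * hs
  ext j
  rw [Hgate_mulVec_apply, hmul]
  rcases ZMod.eq_zero_or_one (f 0) with h0 | h0 <;>
    rcases ZMod.eq_zero_or_one (f 1) with h1 | h1 <;>
    rcases ZMod.eq_zero_or_one j with rfl | rfl <;>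
    norm_num [h0, h1, bv, ZMod.val_one, CharTwo.add_self_eq_zero]

/-- Deutsch's algorithm:
`(H ⊗ I) U_f (H ⊗ H) (I ⊗ X) (b₀ ⊗ b₀) =
  (−1)^{f(0)} · [((1 + (−1)^{f(0)⊕f(1)})/2)·b₀ + ((1 − (−1)^{f(0)⊕f(1)})/2)·b₁]
    ⊗ (1/√2)(b₀ − b₁)`. -/
theorem stmt_5 : ∀ f : ZMod 2 → ZMod 2,
    (kron2 Hgate 1 * Uf f * kron2 Hgate Hgate * kron2 1 Xgate).mulVec
        (tensVec (bv 0) (bv 0)) =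
      ((-1 : ℂ) ^ (f 0).val) •
        tensVec
          (((1 + (-1 : ℂ) ^ (f 0 + f 1).val) / 2) • bv 0 +
            ((1 - (-1 : ℂ) ^ (f 0 + f 1).val) / 2) • bv 1)
          ((1 / (Real.sqrt 2 : ℂ)) • (bv 0 - bv 1)) := by
  intro f
  simp only [← Matrix.mulVec_mulVec, kron2_mulVec_tensVec, Matrix.one_mulVec,
    Xgate_mulVec_bv_zero, Hgate_mulVec_bv_zero, Hgate_mulVec_bv_one,
    Uf_mulVec_tensVec_smul_sub, Hgate_mulVec_phases, tensVec_smul_left]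
end

section
/- Let N > 1 be an integer, let g be a unit in ℤ/Nℤ whose multiplicative order r is even, let a be an integer representing g, and suppose additionally that g^{r/2} ≠ −1 in ℤ/Nℤ. Then gcd(a^{r/2} − 1, N) and gcd(a^{r/2} + 1, N) are nontrivial divisors of N: both are strictly greater than 1 and strictly less than N. -/
/-- If `N` divides `u * v` but neither factor, then `gcd u N` is a nontrivial divisor of `N`. -/
theorem Int.one_lt_gcd_and_gcd_lt_of_dvd_mul {N : ℕ} (hN : 0 < N) {u v : ℤ}
    (huv : (N : ℤ) ∣ u * v) (hu : ¬ (N : ℤ) ∣ u) (hv : ¬ (N : ℤ) ∣ v) :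
    1 < Int.gcd u N ∧ Int.gcd u N < N := by
  have hpos : 0 < Int.gcd u N := Int.gcd_pos_of_ne_zero_right u (by exact_mod_cast hN.ne')
  have hle : Int.gcd u N ≤ N :=
    Nat.le_of_dvd hN (Int.natCast_dvd_natCast.mp (Int.gcd_dvd_right u N))
  refine ⟨lt_of_le_of_ne hpos fun h1 => hv ?_, lt_of_le_of_ne hle fun h1 => hu ?_⟩
  · exact Int.dvd_of_dvd_mul_right_of_gcd_one huv (by rw [Int.gcd_comm, ← h1])
  · have hd := Int.gcd_dvd_left u N
    rwa [h1] at hd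


/-- Let `N > 1`, let `g` be a unit of `ℤ/Nℤ` of even order `r`, let `a : ℤ`
represent `g`, and suppose `g^{r/2} ≠ −1` in `ℤ/Nℤ`. Then `gcd(a^{r/2} − 1, N)`
and `gcd(a^{r/2} + 1, N)` are nontrivial divisors of `N`: strictly between `1` and `N`. -/
theorem stmt_10 (N : ℕ) (hN : 1 < N) (g : (ZMod N)ˣ) (hr : Even (orderOf g))
    (a : ℤ) (ha : (a : ZMod N) = (g : ZMod N))
    (h : (g : ZMod N) ^ (orderOf g / 2) ≠ -1) :
    1 < Int.gcd (a ^ (orderOf g / 2) - 1) (N : ℤ) ∧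
      Int.gcd (a ^ (orderOf g / 2) - 1) (N : ℤ) < N ∧
      1 < Int.gcd (a ^ (orderOf g / 2) + 1) (N : ℤ) ∧
      Int.gcd (a ^ (orderOf g / 2) + 1) (N : ℤ) < N := by
  have hpos : 0 < orderOf g := by
    have : NeZero N := ⟨by omega⟩
    exact orderOf_pos g
  have hhalf : orderOf g / 2 + orderOf g / 2 = orderOf g := by
    obtain ⟨k, hk⟩ := hr
    omega
  have hminus : ¬ (N : ℤ) ∣ a ^ (orderOf g / 2) - 1 := by
    rw [← ZMod.intCast_zmod_eq_zero_iff_dvd]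
    push_cast
    rw [ha, sub_eq_zero]
    intro h1
    exact pow_ne_one_of_lt_orderOf (x := g) (n := orderOf g / 2) (by omega) (by omega)
      (Units.ext (by simpa using h1))
  have hplus : ¬ (N : ℤ) ∣ a ^ (orderOf g / 2) + 1 := by
    rw [← ZMod.intCast_zmod_eq_zero_iff_dvd]
    push_cast
    rwa [ha, ← eq_neg_iff_add_eq_zero]
  have hmul : (N : ℤ) ∣ (a ^ (orderOf g / 2) - 1) * (a ^ (orderOf g / 2) + 1) := by
    have hfactor : (a ^ (orderOf g / 2) - 1) * (a ^ (orderOf g / 2) + 1) =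
        a ^ orderOf g - 1 := by
      conv_rhs => rw [← hhalf, pow_add]
      ring
    rw [hfactor, ← ZMod.intCast_zmod_eq_zero_iff_dvd]
    push_cast
    rw [ha, sub_eq_zero, ← Units.val_pow_eq_pow_val, pow_orderOf_eq_one, Units.val_one]
  have hN0 : 0 < N := by omega
  obtain ⟨h1, h2⟩ := Int.one_lt_gcd_and_gcd_lt_of_dvd_mul hN0 hmul hminus hplus
  obtain ⟨h3, h4⟩ := Int.one_lt_gcd_and_gcd_lt_of_dvd_mul hN0
    (by rwa [mul_comm]) hplus hminus
  exact ⟨h1, h2, h3, h4⟩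
end
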